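/- Let s ≥ 4 and let r be an even integer with 4 ≤ r ≤ 2s - 4. For every real ε > 0 there exists n₀ such that for all n ≥ n₀: every K_s-saturated graph on n vertices that has the minimum number of copies of C_r among all n-vertex K_s-saturated graphs has at most ε·n² edges. -/

import Mathlib

open SimpleGraph Finset

variable {V : Type*}

/-- The graph `G` with the edge `u v` added. -/
def addEdge (G : SimpleGraph V) (u v : V) : SimpleGraph V :=
  G ⊔ SimpleGraph.fromEdgeSet {s(u, v)}

/-- `G` is `K_s`-saturated: `G` is `K_s`-free and adding any missing edge creates a `K_s`. -/
def KSat (s : ℕ) (G : SimpleGraph V) : Prop :=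
  G.CliqueFree s ∧ ∀ u v : V, u ≠ v → ¬ G.Adj u v → ¬ (addEdge G u v).CliqueFree s

/-- The number of copies of `K_r` in `G`: the number of `r`-sets of vertices inducing
a complete graph. -/
noncomputable def cliqueCount (G : SimpleGraph V) (r : ℕ) : ℕ :=
  {t : Finset V | G.IsNClique r t}.ncard

/-- `sat(n, K_r, K_s)`: minimum number of copies of `K_r` in an `n`-vertex
`K_s`-saturated graph. -/
noncomputable def satCliques (n r s : ℕ) : ℕ :=
  sInf {m | ∃ G : SimpleGraph (Fin n), KSat s G ∧ cliqueCount G r = m}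

/-- The join `K_{s-2} ∗ ∅_{n-s+2}` on `Fin n`. -/
def joinGraph (n s : ℕ) : SimpleGraph (Fin n) :=
  SimpleGraph.fromRel (fun i _ => (i : ℕ) < s - 2)

/-- The number of copies of `C_r` in `G` : the number of subgraphs of `G`
isomorphic to the cycle on `r` vertices. -/
noncomputable def cycleCount (G : SimpleGraph V) (r : ℕ) : ℕ :=
  {H : G.Subgraph | Nonempty (H.coe ≃g cycleGraph r)}.ncard

/-- `sat(n, C_r, K_s)`. -/
noncomputable def satCyclesCliqueSat (n r s : ℕ) : ℕ :=
  sInf {m | ∃ G : SimpleGraph (Fin n), KSat s G ∧ cycleCount G r = m}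

/-- `G` contains a copy of `F`, i.e. a subgraph isomorphic to `F`. -/
def ContainsCopy {α β : Type*} (F : SimpleGraph α) (G : SimpleGraph β) : Prop :=
  ∃ f : α → β, Function.Injective f ∧ ∀ a b : α, F.Adj a b → G.Adj (f a) (f b)

/-- strongly K_s-saturated -/
def StronglyKSat (s : ℕ) (G : SimpleGraph V) : Prop :=
  ∀ u v : V, u ≠ v → ¬ G.Adj u v →
    ∃ t : Finset V, (addEdge G u v).IsNClique s t ∧ u ∈ t ∧ v ∈ t

/-- dumbbell -/
def dumbbell (m : ℕ) : SimpleGraph (Fin (2 * m)) :=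
  SimpleGraph.fromRel (fun i j =>
    ((i : ℕ) < m ∧ (j : ℕ) < m) ∨ (m ≤ (i : ℕ) ∧ m ≤ (j : ℕ)) ∨ ((i : ℕ) = 0 ∧ (j : ℕ) = m))

def Vgraph (m : ℕ) : SimpleGraph (Fin (m + 2)) :=
  SimpleGraph.fromRel (fun i j =>
    ((i : ℕ) < m ∧ (j : ℕ) < m) ∨ ((i : ℕ) = 0 ∧ m ≤ (j : ℕ)))

def lambdaGraph (m : ℕ) : SimpleGraph (Fin (m + 1)) :=
  SimpleGraph.fromRel (fun i j =>
    ((i : ℕ) < m ∧ (j : ℕ) < m) ∨ ((i : ℕ) = m ∧ (j : ℕ) < 2))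

def VgraphGen (m r : ℕ) : SimpleGraph (Fin (m + (m - r))) :=
  SimpleGraph.fromRel (fun i j =>
    ((i : ℕ) < m ∧ (j : ℕ) < m) ∨
      (((i : ℕ) = 0 ∨ m ≤ (i : ℕ)) ∧ ((j : ℕ) = 0 ∨ m ≤ (j : ℕ))))

def lambdaGraphGen (m r : ℕ) : SimpleGraph (Fin (m + 1)) :=
  SimpleGraph.fromRel (fun i j =>
    ((i : ℕ) < m ∧ (j : ℕ) < m) ∨ ((i : ℕ) = m ∧ (j : ℕ) < r))

/-- `G` is saturated with respect to the family `{F₁, F₂, F₃}`. -/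
def FamSat3 {α₁ α₂ α₃ : Type*} (F₁ : SimpleGraph α₁) (F₂ : SimpleGraph α₂)
    (F₃ : SimpleGraph α₃) (G : SimpleGraph V) : Prop :=
  ¬ ContainsCopy F₁ G ∧ ¬ ContainsCopy F₂ G ∧ ¬ ContainsCopy F₃ G ∧
    ∀ u v : V, u ≠ v → ¬ G.Adj u v →
      ContainsCopy F₁ (addEdge G u v) ∨ ContainsCopy F₂ (addEdge G u v) ∨
        ContainsCopy F₃ (addEdge G u v)

noncomputable def satFam3 {α₁ α₂ α₃ : Type*} (n : ℕ) (F₁ : SimpleGraph α₁)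
    (F₂ : SimpleGraph α₂) (F₃ : SimpleGraph α₃) : ℕ :=
  sInf {m | ∃ G : SimpleGraph (Fin n), FamSat3 F₁ F₂ F₃ G ∧ G.edgeSet.ncard = m}

noncomputable def satCliquesFam3 {α₁ α₂ α₃ : Type*} (n r : ℕ) (F₁ : SimpleGraph α₁)
    (F₂ : SimpleGraph α₂) (F₃ : SimpleGraph α₃) : ℕ :=
  sInf {m | ∃ G : SimpleGraph (Fin n), FamSat3 F₁ F₂ F₃ G ∧ cliqueCount G r = m}

/-- saturation w.r.t. a single graph, with copies as subgraphs. -/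
def SatGraph {α : Type*} (F : SimpleGraph α) (G : SimpleGraph V) : Prop :=
  ¬ ContainsCopy F G ∧ ∀ u v : V, u ≠ v → ¬ G.Adj u v → ContainsCopy F (addEdge G u v)

noncomputable def satCyclesGraphSat {α : Type*} (n r : ℕ) (F : SimpleGraph α) : ℕ :=
  sInf {m | ∃ G : SimpleGraph (Fin n), SatGraph F G ∧ cycleCount G r = m}

/-- number of independent sets of size l -/
noncomputable def indepCount (G : SimpleGraph V) (l : ℕ) : ℕ :=
  {t : Finset V | t.card = l ∧ ∀ a ∈ t, ∀ b ∈ t, ¬ G.Adj a b}.ncard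

/-- Ramsey number -/
noncomputable def ramsey (l s : ℕ) : ℕ :=
  sInf {N | ∀ G : SimpleGraph (Fin N),
    (∃ t : Finset (Fin N), t.card = l ∧ ∀ a ∈ t, ∀ b ∈ t, ¬ G.Adj a b) ∨
      ∃ t : Finset (Fin N), G.IsNClique s t}

theorem cycleCount_eq_copyCount [Fintype V] (G : SimpleGraph V) (r : ℕ) :
    cycleCount G r = G.copyCount (cycleGraph r) := by
  classical
  rw [cycleCount, copyCount, Set.ncard_eq_toFinset_card']
  congr 1
  ext H
  simp only [Set.toFinset_ofPred, Finset.mem_filter, Finset.mem_univ, true_and]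
  exact ⟨fun ⟨e⟩ => ⟨e.symm⟩, fun ⟨e⟩ => ⟨e.symm⟩⟩

theorem labelledCopyCount_eq_natCard {W : Type*} [Fintype V] [Fintype W]
    (G : SimpleGraph V) (H : SimpleGraph W) : G.labelledCopyCount H = Nat.card (H.Copy G) := by
  rw [labelledCopyCount, Fintype.card_eq_nat_card]

/-- Each unlabelled copy of a graph on `W` comes from at most `|W| ^ |W|` labelled copies. -/
theorem labelledCopyCount_le_mul_copyCount {W : Type*} [Fintype V] [Fintype W]
    (G : SimpleGraph V) (H : SimpleGraph W) :
    G.labelledCopyCount H ≤ Fintype.card W ^ Fintype.card W * G.copyCount H := by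
  classical
  rw [copyCount_eq_card_image_copyToSubgraph, labelledCopyCount, ← Finset.card_univ]
  refine Finset.card_le_mul_card_image _ _ fun K hK => ?_
  obtain ⟨f₀, -, rfl⟩ := Finset.mem_image.1 hK
  have hcard : Fintype.card (W → f₀.toSubgraph.verts) = Fintype.card W ^ Fintype.card W := by
    rw [Fintype.card_fun, Fintype.card_congr f₀.isoToSubgraph.toEquiv]
  rw [← hcard, ← Finset.card_univ]
  have hmem : ∀ f : H.Copy G, f.toSubgraph = f₀.toSubgraph → ∀ w, f w ∈ f₀.toSubgraph.verts := by
    intro f hf w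
    rw [← hf]
    simp
  refine Finset.card_le_card_of_injOn
    (fun f w => if h : f.toSubgraph = f₀.toSubgraph then ⟨f w, hmem f h w⟩
      else f₀.isoToSubgraph w) (by simp) ?_
  intro f hf g hg hfg
  simp only [Finset.coe_filter, Finset.mem_univ, true_and, Set.mem_ofPred_eq] at hf hg
  ext w
  have := congrFun hfg w
  simpa [hf, hg] using this

/-- Tuples whose `j`-th entry is determined by a parameter in `T` and the other entries. -/
theorem card_filter_fun_le {ι β : Type*} [Fintype V] [Fintype ι] [DecidableEq ι] [Fintype β]
    (j : ι) (P : (ι → V) → Prop) [DecidablePred P] (c : (ι → V) → β)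
    (hc : ∀ x y, P x → P y → c x = c y → (∀ i ≠ j, x i = y i) → x j = y j) :
    #{x : ι → V | P x} ≤ Fintype.card β * Fintype.card V ^ (Fintype.card ι - 1) := by
  classical
  have hcard : Fintype.card (β × ({i // i ≠ j} → V)) =
      Fintype.card β * Fintype.card V ^ (Fintype.card ι - 1) := by
    rw [Fintype.card_prod, Fintype.card_fun, Fintype.card_subtype_compl]
    simp
  rw [← hcard, ← Finset.card_univ]
  refine Finset.card_le_card_of_injOn (fun x => (c x, fun i => x i.1)) (by simp) ?_
  intro x hx y hy hxy
  simp only [Finset.coe_filter, Finset.mem_univ, true_and, Set.mem_ofPred_eq] at hx hy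
  rw [Prod.mk.injEq] at hxy
  have hne : ∀ i ≠ j, x i = y i := fun i hi => congrFun hxy.2 ⟨i, hi⟩
  funext i
  by_cases hi : i = j
  · subst hi
    exact hc x y hx hy hxy.1 hne
  · exact hne i hi

open Classical in
theorem card_not_injective_le [Fintype V] (k : ℕ) :
    #{x : Fin k → V | ¬ Function.Injective x} ≤ k ^ 2 * Fintype.card V ^ (k - 1) := by
  have hsub : ({x : Fin k → V | ¬ Function.Injective x} : Finset _) ⊆
      (Finset.univ : Finset (Fin k × Fin k)).biUnion
        (fun p => {x : Fin k → V | x p.1 = x p.2 ∧ p.1 ≠ p.2}) := by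
    intro x hx
    obtain ⟨i, j, h, hij⟩ := Function.not_injective_iff.1 (Finset.mem_filter.1 hx).2
    simp only [Finset.mem_biUnion, Finset.mem_filter, Finset.mem_univ, true_and]
    exact ⟨(i, j), h, hij⟩
  refine (Finset.card_le_card hsub).trans ?_
  refine (Finset.card_biUnion_le_card_mul _ _ (Fintype.card V ^ (k - 1)) ?_).trans ?_
  · intro p _
    have := card_filter_fun_le (V := V) p.2 (fun x : Fin k → V => x p.1 = x p.2 ∧ p.1 ≠ p.2)
      (fun _ => ()) (fun x y hx hy _ h => by rw [← hx.1, ← hy.1, h _ hx.2])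
    simpa using this
  · simp [sq]

open Classical in
/-- Pairs of `k`-tuples spanning a homomorphic image of `K_{k,k}`. -/
noncomputable def bicliquePairs [Fintype V] (G : SimpleGraph V) (k : ℕ) :
    Finset ((Fin k → V) × (Fin k → V)) :=
  {p | ∀ i j, G.Adj (p.1 i) (p.2 j)}

theorem cycleGraph_adj_parity {r : ℕ} (hr : Even r) {u v : Fin r} (h : (cycleGraph r).Adj u v) :
    (u : ℕ) % 2 ≠ (v : ℕ) % 2 := by
  rw [cycleGraph_adj'] at h
  have hr2 := Nat.even_iff.1 hr
  have hu := u.2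
  have hv := v.2
  have key : ∀ a b : Fin r, (a - b : Fin r).val = 1 → (a : ℕ) % 2 ≠ (b : ℕ) % 2 := by
    intro a b hab
    have ha := a.2
    have hb := b.2
    by_cases hle : b ≤ a
    · rw [Fin.sub_val_of_le hle] at hab
      omega
    · rw [Fin.coe_sub_iff_lt.2 (not_le.1 hle)] at hab
      omega
  rcases h with h | h
  · exact key u v h
  · exact (key v u h).symm

/-- Interleaves the two tuples of a biclique into a cycle. -/
theorem exists_copy_of_biclique (G : SimpleGraph V) {k : ℕ} {x y : Fin k → V}
    (hx : Function.Injective x) (hy : Function.Injective y) (h : ∀ i j, G.Adj (x i) (y j)) :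
    ∃ f : (cycleGraph (k + k)).Copy G, ∀ i : Fin (k + k),
      f i = if (i : ℕ) % 2 = 0 then x ⟨i / 2, by omega⟩ else y ⟨i / 2, by omega⟩ := by
  refine ⟨⟨⟨fun i => if (i : ℕ) % 2 = 0 then x ⟨i / 2, by omega⟩ else y ⟨i / 2, by omega⟩, ?_⟩,
    ?_⟩, fun _ => rfl⟩
  · intro a b hab
    have hpar := cycleGraph_adj_parity (Even.add_self k) hab
    by_cases ha : (a : ℕ) % 2 = 0
    · have hb : ¬ (b : ℕ) % 2 = 0 := by omega
      simp only [ha, hb, if_true, if_false]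
      exact h _ _
    · have hb : (b : ℕ) % 2 = 0 := by omega
      simp only [ha, hb, if_true, if_false]
      exact (h _ _).symm
  · intro a b hab
    simp only [RelHom.coeFn_mk] at hab
    by_cases ha : (a : ℕ) % 2 = 0 <;> by_cases hb : (b : ℕ) % 2 = 0 <;>
      simp only [ha, hb, if_true, if_false] at hab
    · have := Fin.mk.inj_iff.1 (hx hab)
      omega
    · exact absurd hab (h _ _).ne
    · exact absurd hab (h _ _).ne'
    · have := Fin.mk.inj_iff.1 (hy hab)
      omega

theorem card_bicliquePairs_le [Fintype V] (G : SimpleGraph V) (k : ℕ) :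
    #(bicliquePairs G k) ≤ (k + k) ^ (k + k) * cycleCount G (k + k) +
      2 * k ^ 2 * Fintype.card V ^ (k - 1) * Fintype.card V ^ k := by
  classical
  set I : Finset (Fin k → V) := {x | ¬ Function.Injective x} with hI
  have hsub : bicliquePairs G k ⊆
      {p ∈ bicliquePairs G k | Function.Injective p.1 ∧ Function.Injective p.2} ∪
        (I ×ˢ Finset.univ ∪ Finset.univ ×ˢ I) := by
    intro p hp
    simp only [hI, Finset.mem_union, Finset.mem_filter, Finset.mem_product, Finset.mem_univ,
      true_and, and_true]
    tauto
  have hinj : #{p ∈ bicliquePairs G k | Function.Injective p.1 ∧ Function.Injective p.2} ≤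
      G.labelledCopyCount (cycleGraph (k + k)) := by
    have hmem : ∀ p ∈ ({p ∈ bicliquePairs G k | Function.Injective p.1 ∧ Function.Injective p.2} :
        Finset _), Function.Injective p.1 ∧ Function.Injective p.2 ∧
          ∀ i j, G.Adj (p.1 i) (p.2 j) := by
      intro p hp
      simp only [bicliquePairs, Finset.mem_filter, Finset.mem_univ, true_and] at hp
      exact ⟨hp.2.1, hp.2.2, hp.1⟩
    choose f hf using fun (p : (Fin k → V) × (Fin k → V))
      (hp : Function.Injective p.1 ∧ Function.Injective p.2 ∧ ∀ i j, G.Adj (p.1 i) (p.2 j)) =>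
      exists_copy_of_biclique G hp.1 hp.2.1 hp.2.2
    rw [labelledCopyCount_eq_natCard, ← Nat.card_eq_finsetCard]
    refine Nat.card_le_card_of_injective (fun p => f p.1 (hmem _ p.2)) ?_
    rintro ⟨p, hp⟩ ⟨q, hq⟩ hpq
    have hval : ∀ i, f p (hmem p hp) i = f q (hmem q hq) i := fun i => by
      exact congrArg (fun g : (cycleGraph (k + k)).Copy G => g i) hpq
    simp only [hf] at hval
    refine Subtype.ext (Prod.ext (funext fun i => ?_) (funext fun i => ?_))
    · have := hval ⟨2 * i, by omega⟩
      simpa using this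
    · have := hval ⟨2 * i + 1, by omega⟩
      have h2 : (2 * (i : ℕ) + 1) / 2 = i := by omega
      simpa [h2] using this
  have hlab := labelledCopyCount_le_mul_copyCount G (cycleGraph (k + k))
  rw [Fintype.card_fin, ← cycleCount_eq_copyCount] at hlab
  have hIcard : #I ≤ k ^ 2 * Fintype.card V ^ (k - 1) := card_not_injective_le k
  refine (Finset.card_le_card hsub).trans <| (Finset.card_union_le _ _).trans <|
    add_le_add (hinj.trans hlab) <| (Finset.card_union_le _ _).trans ?_
  simp only [Finset.card_product, Finset.card_univ, Fintype.card_fun, Fintype.card_fin]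
  calc #I * Fintype.card V ^ k + Fintype.card V ^ k * #I
      = 2 * #I * Fintype.card V ^ k := by ring
    _ ≤ 2 * (k ^ 2 * Fintype.card V ^ (k - 1)) * Fintype.card V ^ k := by gcongr
    _ = _ := by ring

open Classical in
theorem sum_card_common_neighbors [Fintype V] (G : SimpleGraph V) (k : ℕ) :
    ∑ x : Fin k → V, #{v | ∀ i, G.Adj (x i) v} = ∑ v, G.degree v ^ k := by
  simp only [Finset.card_filter]
  rw [Finset.sum_comm]
  refine Finset.sum_congr rfl fun v _ => ?_
  rw [← Finset.card_filter, ← G.card_neighborFinset_eq_degree v]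
  rw [← Fintype.card_piFinset_const]
  congr 1
  ext x
  simp [Fintype.mem_piFinset, G.adj_comm]

open Classical in
theorem card_bicliquePairs [Fintype V] (G : SimpleGraph V) (k : ℕ) :
    #(bicliquePairs G k) = ∑ x : Fin k → V, #{v | ∀ i, G.Adj (x i) v} ^ k := by
  rw [bicliquePairs, Finset.card_filter, Fintype.sum_prod_type]
  refine Finset.sum_congr rfl fun x _ => ?_
  rw [← Finset.card_filter]
  rw [← Fintype.card_piFinset_const]
  congr 1
  ext y
  simp only [Finset.mem_filter, Finset.mem_univ, true_and, Fintype.mem_piFinset]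
  exact forall_comm

theorem two_mul_edges_pow_le [Fintype V] (G : SimpleGraph V) (k : ℕ) :
    (2 * G.edgeSet.ncard) ^ ((k + 1) * (k + 1)) ≤
      Fintype.card V ^ (2 * k * (k + 1)) * #(bicliquePairs G (k + 1)) := by
  classical
  have hdeg : 2 * G.edgeSet.ncard = ∑ v, G.degree v := by
    rw [G.sum_degrees_eq_twice_card_edges, Set.ncard_eq_toFinset_card', edgeFinset]
  have h₁ : (∑ v, G.degree v) ^ (k + 1) ≤
      Fintype.card V ^ k * ∑ v, G.degree v ^ (k + 1) := by
    simpa using pow_sum_le_card_mul_sum_pow (s := Finset.univ) (f := fun v => G.degree v)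
      (fun _ _ => Nat.zero_le _) k
  have h₂ : (∑ x : Fin (k + 1) → V, #{v | ∀ i, G.Adj (x i) v}) ^ (k + 1) ≤
      (Fintype.card V ^ (k + 1)) ^ k *
        ∑ x : Fin (k + 1) → V, #{v | ∀ i, G.Adj (x i) v} ^ (k + 1) := by
    simpa using pow_sum_le_card_mul_sum_pow (s := Finset.univ)
      (f := fun x : Fin (k + 1) → V => #{v | ∀ i, G.Adj (x i) v}) (fun _ _ => Nat.zero_le _) k
  rw [sum_card_common_neighbors, ← card_bicliquePairs] at h₂
  calc (2 * G.edgeSet.ncard) ^ ((k + 1) * (k + 1))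
      = ((∑ v, G.degree v) ^ (k + 1)) ^ (k + 1) := by rw [hdeg, pow_mul]
    _ ≤ (Fintype.card V ^ k * ∑ v, G.degree v ^ (k + 1)) ^ (k + 1) := by gcongr
    _ = Fintype.card V ^ (k * (k + 1)) * (∑ v, G.degree v ^ (k + 1)) ^ (k + 1) := by
      rw [mul_pow, ← pow_mul]
    _ ≤ Fintype.card V ^ (k * (k + 1)) *
        ((Fintype.card V ^ (k + 1)) ^ k * #(bicliquePairs G (k + 1))) := by gcongr
    _ = _ := by
      rw [← mul_assoc, ← pow_mul, ← pow_add]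
      congr 2
      ring

theorem joinGraph_adj {n s : ℕ} {u v : Fin n} :
    (joinGraph n s).Adj u v ↔ u ≠ v ∧ ((u : ℕ) < s - 2 ∨ (v : ℕ) < s - 2) := by
  simp [joinGraph]

theorem kSat_joinGraph {n s : ℕ} (hs : 2 ≤ s) (hn : s ≤ n) : KSat s (joinGraph n s) := by
  classical
  have hcard : #{i : Fin n | (i : ℕ) < s - 2} = s - 2 := by
    rw [Fin.card_filter_val_lt]
    omega
  constructor
  · intro t ht
    have hsplit := Finset.card_filter_add_card_filter_not (s := t) (fun i : Fin n => (i : ℕ) < s - 2)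
    have hle : #(t.filter fun i : Fin n => (i : ℕ) < s - 2) ≤ s - 2 :=
      (Finset.card_le_card (Finset.filter_subset_filter _ (Finset.subset_univ t))).trans hcard.le
    have htc := ht.card_eq
    obtain ⟨a, ha, b, hb, hab⟩ := Finset.one_lt_card.1
      (show 1 < #(t.filter fun i : Fin n => ¬ (i : ℕ) < s - 2) by omega)
    rw [Finset.mem_filter] at ha hb
    have := joinGraph_adj.1 (ht.isClique ha.1 hb.1 hab)
    tauto
  · intro u v huv hadj hfree
    have hlt : ¬ (u : ℕ) < s - 2 ∧ ¬ (v : ℕ) < s - 2 := by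
      rw [joinGraph_adj] at hadj
      tauto
    refine hfree (insert u (insert v (Finset.univ.filter fun i : Fin n => (i : ℕ) < s - 2))) ⟨?_, ?_⟩
    · intro a ha b hb hab
      simp only [Finset.coe_insert, Finset.coe_filter, Finset.mem_univ, true_and,
        Set.mem_insert_iff, Set.mem_ofPred_eq] at ha hb
      simp only [addEdge, sup_adj, joinGraph_adj, fromEdgeSet_adj, Set.mem_singleton_iff,
        Sym2.eq_iff]
      grind
    · rw [Finset.card_insert_of_notMem, Finset.card_insert_of_notMem, hcard]
      · omega
      · simpa using hlt.2
      · simp only [Finset.mem_insert, Finset.mem_filter, Finset.mem_univ, true_and]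
        tauto

theorem cycleCount_joinGraph_le {n s r : ℕ} (hr : 2 ≤ r) :
    cycleCount (joinGraph n s) r ≤ 2 * (s - 2 + 1) * n ^ (r - 1) := by
  classical
  rw [cycleCount_eq_copyCount]
  refine copyCount_le_labelledCopyCount.trans ?_
  rw [labelledCopyCount_eq_natCard]
  obtain ⟨a, b, hab⟩ : ∃ a b : Fin r, (cycleGraph r).Adj b a := by
    refine ⟨⟨0, by omega⟩, ⟨1, by omega⟩, ?_⟩
    rw [cycleGraph_adj']
    left
    rw [Fin.sub_val_of_le (Fin.le_def.2 (Nat.zero_le 1)), Nat.sub_zero]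
  have hP : ∀ j : Fin r, #{x : Fin r → Fin n | (x j : ℕ) < s - 2} ≤
      (s - 2 + 1) * n ^ (r - 1) := by
    intro j
    have := card_filter_fun_le (V := Fin n) (β := Fin (s - 2 + 1)) j
      (fun x : Fin r → Fin n => (x j : ℕ) < s - 2) (fun x => Fin.ofNat _ (x j))
      (fun x y hx hy h _ => by
        have := congrArg Fin.val h
        simp only [Fin.val_ofNat] at this
        rw [Nat.mod_eq_of_lt (by omega), Nat.mod_eq_of_lt (by omega)] at this
        exact Fin.ext this)
    simpa using this
  have hmem : ∀ f : (cycleGraph r).Copy (joinGraph n s), (f : Fin r → Fin n) ∈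
      ({x : Fin r → Fin n | (x a : ℕ) < s - 2} : Finset _) ∪
        ({x : Fin r → Fin n | (x b : ℕ) < s - 2} : Finset _) := by
    intro f
    have := joinGraph_adj.1 (f.toHom.map_adj hab)
    simpa using this.2.symm
  calc Nat.card ((cycleGraph r).Copy (joinGraph n s))
      ≤ Nat.card (({x : Fin r → Fin n | (x a : ℕ) < s - 2} : Finset _) ∪
          ({x : Fin r → Fin n | (x b : ℕ) < s - 2} : Finset _) : Finset _) :=
      Nat.card_le_card_of_injective (fun f => ⟨f, hmem f⟩)
        fun f g hfg => DFunLike.coe_injective (Subtype.mk.inj hfg)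
    _ = _ := Nat.card_eq_finsetCard _
    _ ≤ _ := Finset.card_union_le _ _
    _ ≤ 2 * (s - 2 + 1) * n ^ (r - 1) := by
      have h1 := hP a
      have h2 := hP b
      linarith

/-- Let `s ≥ 4` and `r` even with `4 ≤ r ≤ 2s - 4`. For every `ε > 0` there
is `n₀` such that for all `n ≥ n₀`, every `n`-vertex `K_s`-saturated graph minimizing the
number of copies of `C_r` has at most `ε·n²` edges. -/
theorem edge_bound_even (s r : ℕ) (hs : 4 ≤ s) (heven : Even r) (hr4 : 4 ≤ r)
    (hr : r ≤ 2 * s - 4) (ε : ℝ) (hε : 0 < ε) :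
    ∃ n₀ : ℕ, ∀ n ≥ n₀, ∀ G : SimpleGraph (Fin n), KSat s G →
      (∀ G' : SimpleGraph (Fin n), KSat s G' → cycleCount G r ≤ cycleCount G' r) →
      (G.edgeSet.ncard : ℝ) ≤ ε * (n : ℝ) ^ 2 := by
  obtain ⟨k, rfl⟩ := heven
  obtain ⟨m, rfl⟩ : ∃ m, k = m + 1 := ⟨k - 1, by omega⟩
  set c : ℝ := (2 * ε) ^ ((m + 1) * (m + 1)) with hc
  have hcpos : 0 < c := by positivity
  set r := m + 1 + (m + 1) with hrdef
  set C : ℕ := r ^ r * (2 * (s - 2 + 1)) + 2 * (m + 1) ^ 2 with hC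
  obtain ⟨N, hN⟩ := exists_nat_gt ((C : ℝ) / c)
  refine ⟨max N s, fun n hn G _ hmin => ?_⟩
  have hNn : N ≤ n := (le_max_left _ _).trans hn
  have hsn : s ≤ n := (le_max_right _ _).trans hn
  have hnpos : (0 : ℝ) < n := by
    have : 0 < n := by omega
    exact_mod_cast this
  by_contra! hlt
  have hupper : #(bicliquePairs G (m + 1)) ≤ C * n ^ (2 * m + 1) := by
    have h := card_bicliquePairs_le G (m + 1)
    have hcyc := (hmin _ (kSat_joinGraph (by omega) hsn)).trans
      (cycleCount_joinGraph_le (n := n) (s := s) (r := r) (by omega))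
    have hr1 : r - 1 = 2 * m + 1 := by omega
    rw [hr1] at hcyc
    rw [Fintype.card_fin, ← hrdef] at h
    calc #(bicliquePairs G (m + 1))
        ≤ r ^ r * cycleCount G r + 2 * (m + 1) ^ 2 * n ^ m * n ^ (m + 1) := h
      _ ≤ r ^ r * (2 * (s - 2 + 1) * n ^ (2 * m + 1)) +
          2 * (m + 1) ^ 2 * n ^ m * n ^ (m + 1) := by gcongr
      _ = C * n ^ (2 * m + 1) := by rw [hC]; ring
  have hlower := two_mul_edges_pow_le G m
  rw [Fintype.card_fin] at hlower
  have hchain : c * (n : ℝ) ^ (2 * ((m + 1) * (m + 1))) ≤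
      C * (n : ℝ) ^ (2 * m * (m + 1) + (2 * m + 1)) := by
    calc c * (n : ℝ) ^ (2 * ((m + 1) * (m + 1)))
        = (2 * (ε * (n : ℝ) ^ 2)) ^ ((m + 1) * (m + 1)) := by
          rw [hc, pow_mul (n : ℝ) 2, ← mul_pow, mul_assoc]
      _ ≤ (2 * (G.edgeSet.ncard : ℝ)) ^ ((m + 1) * (m + 1)) := by gcongr
      _ ≤ (n : ℝ) ^ (2 * m * (m + 1)) * #(bicliquePairs G (m + 1)) := by exact_mod_cast hlower
      _ ≤ (n : ℝ) ^ (2 * m * (m + 1)) * (C * (n : ℝ) ^ (2 * m + 1)) := by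
          gcongr
          exact_mod_cast hupper
      _ = _ := by rw [pow_add]; ring
  have hexp : 2 * ((m + 1) * (m + 1)) = 2 * m * (m + 1) + (2 * m + 1) + 1 := by ring
  rw [hexp, pow_succ, mul_comm ((n : ℝ) ^ _), ← mul_assoc] at hchain
  have hcn : c * n ≤ C := le_of_mul_le_mul_right hchain (by positivity)
  have : (C : ℝ) < c * n := by
    rw [div_lt_iff₀ hcpos] at hN
    have : (N : ℝ) ≤ n := by exact_mod_cast hNn
    nlinarith
  linarith
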